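/- (Brezis–Crandall–Pazy) Let B be a real reflexive Banach space (the canonical embedding of B into its double dual is surjective) and let A ⊆ B × B* be maximal monotone. Let (v_n, ξ_n) ∈ A be a sequence such that: ⟨φ, v_n⟩ → ⟨φ, v⟩ for every φ ∈ B* (v_n converges weakly to v in B), ⟨ξ_n, w⟩ → ⟨ξ, w⟩ for every w ∈ B (ξ_n converges weakly to ξ in B*), and limsup_{n → ∞} ⟨ξ_n − ξ, v_n − v⟩ ≤ 0. Then (v, ξ) ∈ A and ⟨ξ_n, v_n⟩ → ⟨ξ, v⟩. -/

import Mathlib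

open Filter Topology

/-- A subset of `B × B*` is monotone if `⟨ξ₁ − ξ₂, v₁ − v₂⟩ ≥ 0` on it. -/
def MonotoneSet {B : Type*} [NormedAddCommGroup B] [NormedSpace ℝ B]
    (A : Set (B × (B →L[ℝ] ℝ))) : Prop :=
  ∀ p ∈ A, ∀ q ∈ A, 0 ≤ (p.2 - q.2) (p.1 - q.1)

/-- A monotone set is maximal monotone if every monotone superset equals it. -/
def MaximalMonotoneSet {B : Type*} [NormedAddCommGroup B] [NormedSpace ℝ B]
    (A : Set (B × (B →L[ℝ] ℝ))) : Prop :=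
  MonotoneSet A ∧ ∀ A' : Set (B × (B →L[ℝ] ℝ)), A ⊆ A' → MonotoneSet A' → A' = A

/-- A pointwise convergent sequence of functionals on a Banach space is bounded in norm. -/
theorem exists_norm_le_of_tendsto_apply {E : Type*} [NormedAddCommGroup E] [NormedSpace ℝ E]
    [CompleteSpace E] {f : ℕ → E →L[ℝ] ℝ} {g : E → ℝ}
    (hf : ∀ x, Tendsto (fun n => f n x) atTop (𝓝 (g x))) : ∃ C, ∀ n, ‖f n‖ ≤ C := by
  refine banach_steinhaus fun x => ?_
  obtain ⟨C, hC⟩ := (Metric.isBounded_range_of_tendsto _ (hf x)).exists_norm_le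
  exact ⟨C, fun n => hC _ ⟨n, rfl⟩⟩

/-- A weakly convergent sequence is bounded in norm. -/
theorem exists_norm_le_of_tendsto_weak {E : Type*} [NormedAddCommGroup E] [NormedSpace ℝ E]
    {x : ℕ → E} {y : E}
    (hx : ∀ φ : E →L[ℝ] ℝ, Tendsto (fun n => φ (x n)) atTop (𝓝 (φ y))) :
    ∃ C, ∀ n, ‖x n‖ ≤ C := by
  obtain ⟨C, hC⟩ := exists_norm_le_of_tendsto_apply (E := E →L[ℝ] ℝ)
    (f := fun n => NormedSpace.inclusionInDoubleDual ℝ E (x n)) (g := fun φ => φ y) hx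
  exact ⟨C, fun n => ((NormedSpace.inclusionInDoubleDualLi ℝ).norm_map (x n)).symm.trans_le (hC n)⟩

/-- A pair monotonically related to all of a maximal monotone set belongs to it. -/
theorem MaximalMonotoneSet.mem_of_forall_nonneg {B : Type*} [NormedAddCommGroup B]
    [NormedSpace ℝ B] {A : Set (B × (B →L[ℝ] ℝ))} (hA : MaximalMonotoneSet A)
    {p : B × (B →L[ℝ] ℝ)} (hp : ∀ q ∈ A, 0 ≤ (p.2 - q.2) (p.1 - q.1)) : p ∈ A := by
  rw [← hA.2 (insert p A) (Set.subset_insert p A) ?_]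
  · exact Set.mem_insert p A
  · rintro q (rfl | hq) r (rfl | hr)
    · simp
    · exact hp r hr
    · rw [← neg_sub r.2 q.2, ← neg_sub r.1 q.1]
      simpa only [map_neg, neg_apply, neg_neg] using hp q hq
    · exact hA.1 q hq r hr

/-- (Brezis–Crandall–Pazy) Let `B` be a reflexive Banach space and `A ⊆ B × B*`
maximal monotone. If `(vₙ, ξₙ) ∈ A`, `vₙ ⇀ v` in `B`, `ξₙ ⇀ ξ` in `B*` and
`limsup ⟨ξₙ − ξ, vₙ − v⟩ ≤ 0`, then `(v, ξ) ∈ A` and `⟨ξₙ, vₙ⟩ → ⟨ξ, v⟩`. -/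
theorem brezis_crandall_pazy {B : Type*} [NormedAddCommGroup B] [NormedSpace ℝ B]
    [CompleteSpace B]
    (hrefl : Function.Surjective (NormedSpace.inclusionInDoubleDual ℝ B))
    (A : Set (B × (B →L[ℝ] ℝ))) (hA : MaximalMonotoneSet A)
    (v : ℕ → B) (ξ : ℕ → (B →L[ℝ] ℝ)) (hmem : ∀ n : ℕ, (v n, ξ n) ∈ A)
    (vlim : B) (ξlim : B →L[ℝ] ℝ)
    (hv : ∀ φ : B →L[ℝ] ℝ, Tendsto (fun n => φ (v n)) atTop (𝓝 (φ vlim)))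
    (hξ : ∀ w : B, Tendsto (fun n => ξ n w) atTop (𝓝 (ξlim w)))
    (hlimsup : limsup (fun n => (ξ n - ξlim) (v n - vlim)) atTop ≤ 0) :
    (vlim, ξlim) ∈ A ∧ Tendsto (fun n => ξ n (v n)) atTop (𝓝 (ξlim vlim)) := by
  obtain ⟨C, hC⟩ := exists_norm_le_of_tendsto_weak hv
  obtain ⟨D, hD⟩ := exists_norm_le_of_tendsto_apply hξ
  have hbdd : IsBoundedUnder (· ≤ ·) atTop (fun n => (ξ n - ξlim) (v n - vlim)) := by
    refine isBoundedUnder_of ⟨(D + ‖ξlim‖) * (C + ‖vlim‖), fun n => ?_⟩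
    have h₁ : ‖ξ n - ξlim‖ ≤ D + ‖ξlim‖ := (norm_sub_le _ _).trans (by gcongr; exact hD n)
    have h₂ : ‖v n - vlim‖ ≤ C + ‖vlim‖ := (norm_sub_le _ _).trans (by gcongr; exact hC n)
    exact (le_abs_self _).trans ((ξ n - ξlim).le_of_opNorm_le_of_le h₁ h₂)
  have hupper : ∀ ε > 0, ∀ᶠ n in atTop, (ξ n - ξlim) (v n - vlim) < ε := fun ε hε =>
    eventually_lt_of_limsup_lt (hlimsup.trans_lt hε) hbdd
  have hA_mem : (vlim, ξlim) ∈ A := by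
    refine hA.mem_of_forall_nonneg fun q hq => le_of_forall_pos_lt_add fun ε hε => ?_
    have hlim : Tendsto (fun n => (ξ n - q.2) (v n - q.1) - (ξ n - ξlim) (v n - vlim)) atTop
        (𝓝 ((ξlim - q.2) (vlim - q.1))) := by
      have h := ((((hv ξlim).sub (hv q.2)).add (hξ vlim)).sub (hξ q.1)).add_const
        (q.2 q.1 - ξlim vlim)
      convert h using 2 <;> simp only [sub_apply, map_sub] <;> ring
    have hge : -(ε / 2) ≤ (ξlim - q.2) (vlim - q.1) := by
      refine ge_of_tendsto hlim ?_
      filter_upwards [hupper (ε / 2) (half_pos hε)] with n hn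
      have := hA.1 _ (hmem n) q hq
      dsimp only at this
      linarith
    dsimp only
    linarith
  refine ⟨hA_mem, ?_⟩
  have hzero : Tendsto (fun n => (ξ n - ξlim) (v n - vlim)) atTop (𝓝 0) := by
    refine tendsto_order.2 ⟨fun a ha => Eventually.of_forall fun n => ?_, hupper⟩
    exact ha.trans_le (hA.1 _ (hmem n) _ hA_mem)
  have h := ((hzero.add (hv ξlim)).add (hξ vlim)).sub_const (ξlim vlim)
  convert h using 2
  · simp only [sub_apply, map_sub]
    ring
  · ring
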